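/- Let ◁ ⊂ ℝ³ be the order simplex with vertices (0,0,0), (1,0,0), (1,1,0), (1,1,1). For all positive real t, A_◁(t) = (1/6)t³ - (1/2)B̄₁(t)t² + (1/24 + (1/2)B̄₂(t) - (1/8)1_ℤ(t))t - B̄₁(t)((1/6)B̄₂(t) + 1/72). In particular A_◁(t) = (1/6)t³ for all positive integers t, so ◁ is a concrete polytope. -/

import Mathlib

open scoped BigOperators
open MeasureTheory
attribute [local instance] Classical.propDecidable

/-- The Euclidean ball of radius `ε` around `c` in `ℝ^d`. -/
def eball {d : ℕ} (c : Fin d → ℝ) (ε : ℝ) : Set (Fin d → ℝ) :=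
  {y | ∑ i, (y i - c i) ^ 2 < ε ^ 2}

/-- `saTendsto Q c ω` says that the solid angle of `Q` at `c` exists and equals `ω`:
the proportion of a small Euclidean ball around `c` occupied by `Q` tends to `ω`. -/
def saTendsto {d : ℕ} (Q : Set (Fin d → ℝ)) (c : Fin d → ℝ) (ω : ℝ) : Prop :=
  Filter.Tendsto
    (fun ε : ℝ => (volume (eball c ε ∩ Q)).toReal / (volume (eball c ε)).toReal)
    (nhdsWithin 0 (Set.Ioi 0)) (nhds ω)

open Pointwise

/-- Periodized first Bernoulli polynomial. -/
noncomputable def B1bar (x : ℝ) : ℝ := if ∃ n : ℤ, x = n then 0 else Int.fract x - 1/2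

/-- Periodized second Bernoulli polynomial. -/
noncomputable def B2bar (x : ℝ) : ℝ := (Int.fract x)^2 - Int.fract x + 1/6

/-- Indicator function of the integers. -/
noncomputable def indZ (x : ℝ) : ℝ := if ∃ n : ℤ, x = n then 1 else 0

/-- The order simplex in `ℝ³`, with vertices `(0,0,0), (1,0,0), (1,1,0), (1,1,1)`. -/
noncomputable def orderSimplex3 : Set (Fin 3 → ℝ) :=
  convexHull ℝ {![0,0,0], ![1,0,0], ![1,1,0], ![1,1,1]}


lemma mem_simplex (t : ℝ) (ht : 0 < t) (x : Fin 3 → ℝ) :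
    x ∈ t • orderSimplex3 ↔ x 0 ≤ t ∧ x 1 ≤ x 0 ∧ x 2 ≤ x 1 ∧ 0 ≤ x 2 := by
  have key : ∀ y : Fin 3 → ℝ, y ∈ orderSimplex3 ↔ y 0 ≤ 1 ∧ y 1 ≤ y 0 ∧ y 2 ≤ y 1 ∧ 0 ≤ y 2 := by
    intro y
    constructor
    · intro hy
      have hc : Convex ℝ {y : Fin 3 → ℝ | y 0 ≤ 1 ∧ y 1 ≤ y 0 ∧ y 2 ≤ y 1 ∧ 0 ≤ y 2} := by
        rintro a ⟨a1, a2, a3, a4⟩ b ⟨b1, b2, b3, b4⟩ u v hu hv huv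
        simp only [Set.mem_ofPred_eq, Pi.add_apply, Pi.smul_apply, smul_eq_mul]
        refine ⟨?_, ?_, ?_, ?_⟩ <;> nlinarith
      refine convexHull_min ?_ hc hy
      intro z hz
      simp only [Set.mem_insert_iff, Set.mem_singleton_iff] at hz
      rcases hz with rfl | rfl | rfl | rfl <;> simp
    · rintro ⟨h1, h2, h3, h4⟩
      have := (convex_convexHull ℝ ({![0,0,0], ![1,0,0], ![1,1,0], ![1,1,1]} : Set (Fin 3 → ℝ))).sum_mem
        (t := (Finset.univ : Finset (Fin 4)))
        (w := ![1 - y 0, y 0 - y 1, y 1 - y 2, y 2])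
        (z := ![![0,0,0], ![1,0,0], ![1,1,0], ![1,1,1]])
        (by intro i _; fin_cases i <;> simp <;> linarith)
        (by simp [Fin.sum_univ_four])
        (by intro i _; apply subset_convexHull; fin_cases i <;> simp)
      unfold orderSimplex3
      convert this using 1
      ext i
      fin_cases i <;> simp [Fin.sum_univ_four]
  rw [Set.mem_smul_set_iff_inv_smul_mem₀ ht.ne', key]
  simp only [Pi.smul_apply, smul_eq_mul]
  have hi : 0 < t⁻¹ := inv_pos.mpr ht
  have e1 : t⁻¹ * x 0 ≤ 1 ↔ x 0 ≤ t := by rw [inv_mul_le_iff₀ ht]; simp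
  rw [e1, mul_le_mul_iff_right₀ hi, mul_le_mul_iff_right₀ hi, mul_nonneg_iff_of_pos_left hi]

abbrev BG := Equiv.Perm (Fin 3) × (Fin 3 → ℤˣ)

def act (p : BG) (x : Fin 3 → ℝ) : Fin 3 → ℝ := fun i => ((p.2 i : ℤ) : ℝ) * x (p.1 i)

def actZ (p : BG) : (Fin 3 → ℤ) ≃ (Fin 3 → ℤ) where
  toFun n i := (p.2 i : ℤ) * n (p.1 i)
  invFun m j := (p.2 (p.1.symm j) : ℤ) * m (p.1.symm j)
  left_inv n := by
    ext j
    simp [← mul_assoc, ← Units.val_mul]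
  right_inv n := by
    ext j
    simp [← mul_assoc, ← Units.val_mul]

lemma sgn_sq (u : ℤˣ) : ((u : ℤ) : ℝ) ^ 2 = 1 := by
  rcases Int.units_eq_one_or u with rfl | rfl <;> simp

lemma mp_sgn (u : ℤˣ) (c : ℝ) : MeasurePreserving (fun x : ℝ => c + ((u : ℤ) : ℝ) * (x - c)) := by
  rcases Int.units_eq_one_or u with rfl | rfl
  · have := MeasurePreserving.id (volume : Measure ℝ)
    have e : (fun x : ℝ => c + (((1 : ℤˣ) : ℤ) : ℝ) * (x - c)) = id := by funext x; simp
    rw [e]; exact this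
  · have := Measure.measurePreserving_sub_left (volume : Measure ℝ) (c + c)
    have e : (fun x : ℝ => c + (((-1 : ℤˣ) : ℤ) : ℝ) * (x - c)) = fun x => c + c - x := by
      funext x; push_cast; ring
    rw [e]; exact this

lemma mp_act (p : BG) : MeasurePreserving (act p) := by
  have h1 := volume_preserving_pi (fun i => mp_sgn (p.2 i) 0)
  have h2 := volume_measurePreserving_piCongrLeft (fun _ : Fin 3 => ℝ) p.1.symm
  have h3 := h1.comp h2
  have e : act p = (fun a i => 0 + ((p.2 i : ℤ) : ℝ) * (a i - 0)) ∘
      (MeasurableEquiv.piCongrLeft (fun _ : Fin 3 => ℝ) p.1.symm) := by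
    funext x i
    simp [act, MeasurableEquiv.piCongrLeft, Equiv.piCongrLeft]
  rw [e]; exact h3

lemma mp_refl (s : Fin 3 → ℤˣ) (c : Fin 3 → ℝ) :
    MeasurePreserving (fun x : Fin 3 → ℝ => fun i => c i + ((s i : ℤ) : ℝ) * (x i - c i)) :=
  volume_preserving_pi (fun i => mp_sgn (s i) (c i))

lemma null_lin (φ : (Fin 3 → ℝ) →ₗ[ℝ] ℝ) (h : ∃ x, φ x ≠ 0) (a : ℝ) :
    volume {y | φ y = a} = 0 := by
  obtain ⟨x, hx⟩ := h
  by_cases hne : ∃ z, φ z = a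
  · obtain ⟨z, hz⟩ := hne
    have hk : volume ((LinearMap.ker φ : Submodule ℝ (Fin 3 → ℝ)) : Set (Fin 3 → ℝ)) = 0 := by
      apply Measure.addHaar_submodule
      intro h
      apply hx
      have : x ∈ LinearMap.ker φ := h ▸ Submodule.mem_top
      exact this
    have : {y | φ y = a} = (fun y => y + -z) ⁻¹' (LinearMap.ker φ : Set (Fin 3 → ℝ)) := by
      ext y
      simp [hz, add_neg_eq_zero]
    rw [this, measure_preimage_add_right, hk]
  · have : {y | φ y = a} = ∅ := by
      ext y; simp; exact fun h => hne ⟨y, h⟩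
    simp [this]

lemma eball_meas (c : Fin 3 → ℝ) (ε : ℝ) : IsOpen (eball c ε) := by
  unfold eball
  apply isOpen_lt <;> fun_prop

lemma eball_coord {c y : Fin 3 → ℝ} {ε : ℝ} (hε : 0 < ε) (hy : y ∈ eball c ε) (i : Fin 3) :
    |y i - c i| < ε := by
  have h : (y i - c i) ^ 2 ≤ ∑ i, (y i - c i) ^ 2 :=
    Finset.single_le_sum (f := fun i => (y i - c i) ^ 2) (fun i _ => sq_nonneg _) (Finset.mem_univ i)
  exact abs_lt_of_sq_lt_sq (lt_of_le_of_lt h hy) hε.le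

lemma eball_fin (c : Fin 3 → ℝ) {ε : ℝ} (hε : 0 < ε) : volume (eball c ε) ≠ ⊤ := by
  apply ne_top_of_le_ne_top (b := volume (Metric.closedBall c ε))
  · exact measure_closedBall_lt_top.ne
  · apply measure_mono
    intro y hy
    rw [Metric.mem_closedBall, dist_pi_le_iff hε.le]
    intro i
    rw [Real.dist_eq]
    exact (eball_coord hε hy i).le

lemma eball_pos (c : Fin 3 → ℝ) {ε : ℝ} (hε : 0 < ε) : volume (eball c ε) ≠ 0 := by
  apply ((eball_meas c ε).measure_pos volume ⟨c, _⟩).ne'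
  simp [eball]; positivity

lemma eball_act (p : BG) (c : Fin 3 → ℝ) (ε : ℝ) : act p ⁻¹' (eball (act p c) ε) = eball c ε := by
  ext y
  simp only [eball, act, Set.mem_preimage, Set.mem_ofPred_eq, ← mul_sub, mul_pow, sgn_sq, one_mul]
  rw [Equiv.sum_comp p.1 (fun j => (y j - c j) ^ 2)]

lemma eball_refl (s : Fin 3 → ℤˣ) (c : Fin 3 → ℝ) (ε : ℝ) :
    (fun x : Fin 3 → ℝ => fun i => c i + ((s i : ℤ) : ℝ) * (x i - c i)) ⁻¹' (eball c ε) = eball c ε := by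
  ext y
  simp only [eball, Set.mem_preimage, Set.mem_ofPred_eq, add_sub_cancel_left, mul_pow, sgn_sq, one_mul]

def cube (t : ℝ) : Set (Fin 3 → ℝ) := {y | ∀ i, |y i| ≤ t}

lemma cube_meas (t : ℝ) : MeasurableSet (cube t) := by
  apply IsClosed.measurableSet
  have : cube t = ⋂ i, {y : Fin 3 → ℝ | |y i| ≤ t} := by ext; simp [cube]
  rw [this]
  exact isClosed_iInter fun i => isClosed_le (by fun_prop) (by fun_prop)

lemma simplex_meas (t : ℝ) (ht : 0 < t) : MeasurableSet (t • orderSimplex3) := by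
  apply IsClosed.measurableSet
  have : t • orderSimplex3 = {x : Fin 3 → ℝ | x 0 ≤ t ∧ x 1 ≤ x 0 ∧ x 2 ≤ x 1 ∧ 0 ≤ x 2} := by
    ext x; exact mem_simplex t ht x
  rw [this]
  have c : ∀ i : Fin 3, Continuous fun x : Fin 3 → ℝ => x i := fun i => continuous_apply i
  exact (isClosed_le (c 0) continuous_const).inter ((isClosed_le (c 1) (c 0)).inter
    ((isClosed_le (c 2) (c 1)).inter (isClosed_le continuous_const (c 2))))

/-- The generic points. -/
def gen : Set (Fin 3 → ℝ) := {y | (∀ i, y i ≠ 0) ∧ Function.Injective fun i => |y i|}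

abbrev prj (i : Fin 3) : (Fin 3 → ℝ) →ₗ[ℝ] ℝ := LinearMap.proj i

lemma gen_null : volume (genᶜ) = 0 := by
  have h : genᶜ ⊆ (⋃ i : Fin 3, {y : Fin 3 → ℝ | prj i y = 0}) ∪
     ⋃ q : {q : Fin 3 × Fin 3 // q.1 ≠ q.2},
      ({y | (prj q.1.1 - prj q.1.2) y = 0} ∪
       {y | (prj q.1.1 + prj q.1.2) y = 0}) := by
    intro y hy
    simp only [gen, Set.mem_compl_iff, Set.mem_ofPred_eq, not_and_or] at hy
    rcases hy with hy | hy
    · left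
      push Not at hy
      simpa using hy
    · right
      simp only [Function.Injective] at hy
      push Not at hy
      obtain ⟨i, j, hij, hne⟩ := hy
      refine Set.mem_iUnion.2 ⟨⟨(i, j), hne⟩, ?_⟩
      rcases abs_eq_abs.1 hij with h | h
      · left; simp [h]
      · right; simp [h]
  apply measure_mono_null h
  rw [measure_union_null_iff, measure_iUnion_null_iff, measure_iUnion_null_iff]
  refine ⟨fun i => null_lin _ ⟨Pi.single i 1, by simp⟩ 0, ?_⟩
  rintro ⟨⟨i, j⟩, hij⟩
  simp only [ne_eq] at hij
  rw [measure_union_null_iff]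
  exact ⟨null_lin _ ⟨Pi.single i 1, by simp [Pi.single_apply, Ne.symm hij]⟩ 0,
    null_lin _ ⟨Pi.single i 1, by simp [Pi.single_apply, Ne.symm hij]⟩ 0⟩

lemma act_mem (t : ℝ) (ht : 0 < t) (p : BG) (y : Fin 3 → ℝ) (h : act p y ∈ t • orderSimplex3) :
    (∀ i, act p y i = |y (p.1 i)|) ∧ Monotone ((fun i => -|y i|) ∘ p.1) ∧ y ∈ cube t := by
  rw [mem_simplex t ht] at h
  obtain ⟨h1, h2, h3, h4⟩ := h
  have hn : ∀ i, 0 ≤ act p y i ∧ act p y i ≤ t := by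
    intro i; fin_cases i <;> simp <;> constructor <;> linarith
  have ha : ∀ i, act p y i = |y (p.1 i)| := by
    intro i
    rw [← abs_of_nonneg (hn i).1]
    unfold act
    rw [abs_mul, ← sq_eq_sq₀ (by positivity) (by positivity), mul_pow, sq_abs, sgn_sq, one_mul]
  refine ⟨ha, ?_, ?_⟩
  · rw [Fin.monotone_iff_le_succ]
    intro i
    fin_cases i
    · simpa [← ha] using h2
    · simpa [← ha] using h3
  · intro i
    have := (hn (p.1.symm i)).2
    rw [ha] at this
    simpa using this

lemma union_act (t : ℝ) (ht : 0 < t) : ⋃ p : BG, act p ⁻¹' (t • orderSimplex3) = cube t := by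
  ext y
  simp only [Set.mem_iUnion, Set.mem_preimage]
  constructor
  · rintro ⟨p, hp⟩
    exact (act_mem t ht p y hp).2.2
  · intro hy
    let σ := Tuple.sort (fun i => -|y i|)
    have hσ : Monotone ((fun i => -|y i|) ∘ σ) := Tuple.monotone_sort _
    let s : Fin 3 → ℤˣ := fun i => if 0 ≤ y (σ i) then 1 else -1
    have ha : ∀ i, act (σ, s) y i = |y (σ i)| := by
      intro i
      simp only [act, s]
      split_ifs with h
      · simp [abs_of_nonneg h]
      · simp [abs_of_neg (not_le.1 h)]
    refine ⟨(σ, s), ?_⟩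
    rw [mem_simplex t ht]
    simp only [ha]
    have h01 := hσ (show (0 : Fin 3) ≤ 1 by decide)
    have h12 := hσ (show (1 : Fin 3) ≤ 2 by decide)
    simp only [Function.comp] at h01 h12
    exact ⟨hy _, by linarith, by linarith, abs_nonneg _⟩

lemma act_unique (t : ℝ) (ht : 0 < t) (p q : BG) (y : Fin 3 → ℝ) (hy : y ∈ gen)
    (hp : act p y ∈ t • orderSimplex3) (hq : act q y ∈ t • orderSimplex3) : p = q := by
  obtain ⟨p1, p2, -⟩ := act_mem t ht p y hp
  obtain ⟨q1, q2, -⟩ := act_mem t ht q y hq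
  have h := Tuple.unique_monotone p2 q2
  have h1 : p.1 = q.1 := by
    ext1 i
    have := congrFun h i
    simp only [Function.comp, neg_inj] at this
    exact hy.2 this
  refine Prod.ext h1 ?_
  ext1 i
  have e := (p1 i).trans (by rw [h1, ← q1 i])
  simp only [act] at e
  rw [h1] at e
  have ee := mul_right_cancel₀ (hy.1 _) e
  exact Units.ext (by exact_mod_cast ee)

lemma sum_act (t : ℝ) (ht : 0 < t) (c : Fin 3 → ℝ) (ε : ℝ) :
    ∑ p : BG, volume (eball (act p c) ε ∩ t • orderSimplex3) = volume (eball c ε ∩ cube t) := by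
  have hm := simplex_meas t ht
  rw [← union_act t ht, Set.inter_iUnion, measure_iUnion₀, tsum_fintype]
  · refine Finset.sum_congr rfl fun p _ => ?_
    rw [← (mp_act p).measure_preimage ((eball_meas _ _).measurableSet.inter hm).nullMeasurableSet,
      Set.preimage_inter, eball_act]
  · intro p q hpq
    refine measure_mono_null ?_ gen_null
    rintro y ⟨⟨-, h1⟩, ⟨-, h2⟩⟩ hy
    exact hpq (act_unique t ht p q y hy h1 h2)
  · intro p
    exact ((eball_meas _ _).measurableSet.inter ((mp_act p).measurable hm)).nullMeasurableSet

/-- Twice the one-dimensional solid angle of `[-t, t]` at `x`. -/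
noncomputable def uu (t x : ℝ) : ℕ := if |x| < t then 2 else if |x| = t then 1 else 0

lemma uu_local (t : ℝ) (ht : 0 < t) (c : ℝ) : ∃ δ > 0, ∀ y, |y - c| < δ → y ≠ c →
    ∑ u : ℤˣ, (if |c + ((u : ℤ) : ℝ) * (y - c)| ≤ t then 1 else 0) = uu t c := by
  have hs : ∀ y, ∑ u : ℤˣ, (if |c + ((u : ℤ) : ℝ) * (y - c)| ≤ t then 1 else 0) =
      (if |y| ≤ t then 1 else 0) + (if |2 * c - y| ≤ t then 1 else 0) := by
    intro y
    have : (Finset.univ : Finset ℤˣ) = {1, -1} := rfl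
    rw [this, Finset.sum_pair (by decide)]
    have e1 : c + (((1 : ℤˣ) : ℤ) : ℝ) * (y - c) = y := by push_cast; ring
    have e2 : c + (((-1 : ℤˣ) : ℤ) : ℝ) * (y - c) = 2 * c - y := by push_cast; ring
    rw [e1, e2]
  simp only [hs, uu]
  rcases lt_trichotomy (|c|) t with h | h | h
  · refine ⟨t - |c|, by linarith, fun y hy _ => ?_⟩
    rw [abs_lt] at hy
    have a1 : |y| ≤ t := by
      rw [abs_le]; constructor <;> linarith [le_abs_self c, neg_abs_le c]
    have a2 : |2 * c - y| ≤ t := by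
      rw [abs_le]; constructor <;> linarith [le_abs_self c, neg_abs_le c]
    simp [a1, a2, h]
  · refine ⟨t, ht, fun y hy hne => ?_⟩
    rw [abs_lt] at hy
    rw [if_neg (by linarith : ¬ |c| < t), if_pos h]
    rcases (abs_eq ht.le).1 h with rfl | rfl
    · rcases lt_or_gt_of_ne hne with hl | hl
      · rw [if_pos, if_neg]
        · rw [abs_le]; intro h; linarith [h.2]
        · rw [abs_le]; constructor <;> linarith
      · rw [if_neg, if_pos]
        · rw [abs_le]; constructor <;> linarith
        · rw [abs_le]; intro h; linarith [h.2]
    · rcases lt_or_gt_of_ne hne with hl | hl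
      · rw [if_neg, if_pos]
        · rw [abs_le]; constructor <;> linarith
        · rw [abs_le]; intro h; linarith [h.1]
      · rw [if_pos, if_neg]
        · rw [abs_le]; intro h; linarith [h.1]
        · rw [abs_le]; constructor <;> linarith
  · refine ⟨|c| - t, by linarith, fun y hy _ => ?_⟩
    have a1 : ¬ |y| ≤ t := by
      intro h1
      have := abs_sub_abs_le_abs_sub c y
      rw [abs_sub_comm] at this
      linarith
    have a2 : ¬ |2 * c - y| ≤ t := by
      intro h1
      have := abs_sub_abs_le_abs_sub c (2 * c - y)
      rw [show c - (2 * c - y) = y - c by ring] at this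
      linarith
    rw [if_neg a1, if_neg a2, if_neg (by linarith), if_neg (by linarith)]

lemma cube_local (t : ℝ) (ht : 0 < t) (c : Fin 3 → ℝ) : ∃ δ > 0, ∀ ε, 0 < ε → ε < δ →
    8 * volume (eball c ε ∩ cube t) = ((∏ i, uu t (c i) : ℕ) : ENNReal) * volume (eball c ε) := by
  choose d hd hl using fun i => uu_local t ht (c i)
  refine ⟨min (d 0) (min (d 1) (d 2)), by simp [hd], fun ε hε hlt => ?_⟩
  have hdd : ∀ i, ε < d i := by
    simp only [lt_min_iff] at hlt
    intro i; fin_cases i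
    exacts [hlt.1, hlt.2.1, hlt.2.2]
  have hm := cube_meas t
  have hb := (eball_meas c ε).measurableSet
  let r : (Fin 3 → ℤˣ) → (Fin 3 → ℝ) → (Fin 3 → ℝ) :=
    fun s x i => c i + ((s i : ℤ) : ℝ) * (x i - c i)
  have hr : ∀ s, volume (eball c ε ∩ cube t) = ∫⁻ y in eball c ε, (r s ⁻¹' cube t).indicator 1 y := by
    intro s
    have hms : MeasurableSet (r s ⁻¹' cube t) := (mp_refl s c).measurable hm
    rw [lintegral_indicator_one hms, Measure.restrict_apply hms, Set.inter_comm,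
      ← (mp_refl s c).measure_preimage (hm.inter hb).nullMeasurableSet,
      Set.preimage_inter, eball_refl]
  have h8 : 8 * volume (eball c ε ∩ cube t) = ∑ s : Fin 3 → ℤˣ, volume (eball c ε ∩ cube t) := by
    rw [Finset.sum_const, Finset.card_univ, nsmul_eq_mul]
    congr 1
  rw [h8, Finset.sum_congr rfl (fun s _ => hr s), ← lintegral_finsetSum]
  · rw [← setLIntegral_const]
    apply setLIntegral_congr_fun_ae hb
    have hae : ∀ᵐ y : Fin 3 → ℝ, ∀ i, y i ≠ c i := by
      rw [ae_all_iff]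
      intro i
      have := null_lin (prj i) ⟨Pi.single i 1, by simp⟩ (c i)
      rw [ae_iff]
      simpa using this
    filter_upwards [hae] with y hy hyb
    have hi : ∀ s, (r s ⁻¹' cube t).indicator (1 : (Fin 3 → ℝ) → ENNReal) y =
        ((∏ i, if |c i + ((s i : ℤ) : ℝ) * (y i - c i)| ≤ t then 1 else 0 : ℕ) : ENNReal) := by
      intro s
      rw [Set.indicator_apply, Finset.prod_ite_zero]
      by_cases h : ∀ i, |c i + ((s i : ℤ) : ℝ) * (y i - c i)| ≤ t
      · rw [if_pos (show y ∈ r s ⁻¹' cube t from h), if_pos (fun i _ => h i)]; simp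
      · rw [if_neg (show ¬ y ∈ r s ⁻¹' cube t from h), if_neg (fun hh => h fun i => hh i (Finset.mem_univ i))]
        simp
    simp only [hi]
    rw [← Nat.cast_sum]
    congr 1
    rw [Finset.prod_congr rfl (fun i _ => (hl i (y i) ((eball_coord hε hyb i).trans (hdd i)) (hy i)).symm)]
    rw [Finset.prod_univ_sum]
    rfl
  · intro s _
    exact measurable_one.indicator ((mp_refl s c).measurable hm)

lemma sum_omega (t : ℝ) (ht : 0 < t) (ω : (Fin 3 → ℤ) → ℝ)
    (hω : ∀ n : Fin 3 → ℤ, saTendsto (t • orderSimplex3) (fun i => (n i : ℝ)) (ω n))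
    (n : Fin 3 → ℤ) : ∑ p : BG, ω (actZ p n) = ∏ i, ((uu t (n i) : ℝ) / 2) := by
  have h1 := tendsto_finsetSum (Finset.univ : Finset BG) (fun p _ => hω (actZ p n))
  refine tendsto_nhds_unique h1 ?_
  obtain ⟨δ, hδ, hl⟩ := cube_local t ht (fun i => (n i : ℝ))
  refine tendsto_const_nhds.congr' ?_
  filter_upwards [Ioo_mem_nhdsGT hδ] with ε hε
  have ha : ∀ p : BG, (fun i => ((actZ p n i : ℤ) : ℝ)) = act p (fun i => (n i : ℝ)) := by
    intro p; ext i; simp [act, actZ]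
  have hv : ∀ p : BG, volume (eball (act p (fun i => (n i : ℝ))) ε) = volume (eball (fun i => (n i : ℝ)) ε) := by
    intro p
    rw [← (mp_act p).measure_preimage (eball_meas _ _).measurableSet.nullMeasurableSet, eball_act]
  simp only [ha, hv]
  rw [← Finset.sum_div, ← ENNReal.toReal_sum, sum_act t ht]
  · have h := congrArg ENNReal.toReal (hl ε hε.1 hε.2)
    rw [ENNReal.toReal_mul, ENNReal.toReal_mul, ENNReal.toReal_natCast] at h
    have hp : (volume (eball (fun i => (n i : ℝ)) ε)).toReal ≠ 0 :=
      ENNReal.toReal_ne_zero.2 ⟨eball_pos _ hε.1, eball_fin _ hε.1⟩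
    rw [eq_div_iff hp, Finset.prod_div_distrib]
    simp only [Finset.prod_const, Finset.card_univ, Fintype.card_fin]
    push_cast at h
    have e8 : (8 : ENNReal).toReal = 8 := by simp
    rw [e8] at h
    linarith
  · intro p _
    exact ne_top_of_le_ne_top (eball_fin _ hε.1) (measure_mono Set.inter_subset_left)

lemma omega_nonneg (t : ℝ) (ω : (Fin 3 → ℤ) → ℝ)
    (hω : ∀ n : Fin 3 → ℤ, saTendsto (t • orderSimplex3) (fun i => (n i : ℝ)) (ω n))
    (n : Fin 3 → ℤ) : 0 ≤ ω n :=
  ge_of_tendsto' (hω n) fun ε => by positivity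

lemma uu_zero (t : ℝ) (k : ℤ) (hk : k ∉ Finset.Icc (-⌊t⌋) ⌊t⌋) : uu t k = 0 := by
  have h : t < |(k : ℝ)| := by
    by_contra h
    apply hk
    rw [not_lt, abs_le] at h
    rw [Finset.mem_Icc]
    have h2 : k ≤ ⌊t⌋ := Int.le_floor.2 h.2
    have h3 : -k ≤ ⌊t⌋ := Int.le_floor.2 (by push_cast; linarith)
    exact ⟨by linarith, h2⟩
  unfold uu
  rw [if_neg (by linarith), if_neg (by linarith)]

lemma uu_sum (t : ℝ) (ht : 0 < t) :
    ∑ k ∈ Finset.Icc (-⌊t⌋) ⌊t⌋, ((uu t k : ℝ) / 2) = 2 * (t - B1bar t) := by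
  have hf0 : 0 ≤ ⌊t⌋ := Int.floor_nonneg.2 ht.le
  have hcard : ((Finset.Icc (-⌊t⌋) ⌊t⌋).card : ℝ) = 2 * ⌊t⌋ + 1 := by
    rw [Int.card_Icc]
    have : (((⌊t⌋ + 1 - -⌊t⌋).toNat : ℤ) : ℝ) = ((⌊t⌋ + 1 - -⌊t⌋ : ℤ) : ℝ) := by
      rw [Int.toNat_of_nonneg (by linarith)]
    push_cast at this
    rw [this]; ring
  have hle : ∀ k ∈ Finset.Icc (-⌊t⌋) ⌊t⌋, |(k : ℝ)| ≤ t := by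
    intro k hk
    rw [Finset.mem_Icc] at hk
    have h1 : (k : ℝ) ≤ ⌊t⌋ := by exact_mod_cast hk.2
    have h2 : (-⌊t⌋ : ℝ) ≤ k := by exact_mod_cast hk.1
    rw [abs_le]; constructor <;> linarith [Int.floor_le t]
  have hsum : ∀ k ∈ Finset.Icc (-⌊t⌋) ⌊t⌋, ((uu t k : ℝ) / 2) =
      1 - ((if (k : ℝ) = t then 1/2 else 0) + (if (k : ℝ) = -t then 1/2 else 0)) := by
    intro k hk
    unfold uu
    rcases (hle k hk).lt_or_eq with h | h
    · have hh := abs_lt.1 h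
      rw [if_pos h, if_neg hh.2.ne, if_neg hh.1.ne']
      norm_num
    · rw [if_neg (by linarith), if_pos h]
      rcases (abs_eq ht.le).1 h with h | h <;> rw [h]
      · rw [if_pos rfl, if_neg (by linarith)]; norm_num
      · rw [if_neg (by linarith), if_pos rfl]; norm_num
  rw [Finset.sum_congr rfl hsum, Finset.sum_sub_distrib, Finset.sum_add_distrib]
  simp only [Finset.sum_const, nsmul_eq_mul, hcard]
  unfold B1bar
  split_ifs with h
  · obtain ⟨m, rfl⟩ := h
    have hm : (0 : ℤ) < m := by exact_mod_cast ht
    simp only [Int.floor_intCast]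
    have e1 : ∀ k : ℤ, ((k : ℝ) = -(m : ℝ)) ↔ k = -m := fun k => by
      rw [← Int.cast_neg, Int.cast_inj]
    simp only [Int.cast_inj, e1, Finset.sum_ite_eq']
    rw [if_pos (by rw [Finset.mem_Icc]; constructor <;> linarith),
      if_pos (by rw [Finset.mem_Icc]; constructor <;> linarith)]
    ring
  · have e1 : ∀ k : ℤ, ¬ (k : ℝ) = t := fun k hk => h ⟨k, hk.symm⟩
    have e2 : ∀ k : ℤ, ¬ (k : ℝ) = -t := fun k hk => h ⟨-k, by push_cast; linarith⟩
    simp only [e1, e2, if_false, Finset.sum_const_zero]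
    have := Int.floor_add_fract t
    linarith

lemma main_sum (t : ℝ) (ht : 0 < t) (ω : (Fin 3 → ℤ) → ℝ)
    (hω : ∀ n : Fin 3 → ℤ, saTendsto (t • orderSimplex3) (fun i => (n i : ℝ)) (ω n)) :
    ∑' n, ω n = (t - B1bar t) ^ 3 / 6 := by
  let S := Fintype.piFinset fun _ : Fin 3 => Finset.Icc (-⌊t⌋) ⌊t⌋
  have hW : ∀ n : Fin 3 → ℤ, n ∉ S → ∏ i, ((uu t (n i) : ℝ) / 2) = 0 := by
    intro n hn
    simp only [S, Fintype.mem_piFinset] at hn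
    push Not at hn
    obtain ⟨i, hi⟩ := hn
    exact Finset.prod_eq_zero (Finset.mem_univ i) (by rw [uu_zero t _ hi]; simp)
  have hsupp : ∀ n, n ∉ S → ω n = 0 := by
    intro n hn
    have h := sum_omega t ht ω hω n
    rw [hW n hn, Finset.sum_eq_zero_iff_of_nonneg (fun p _ => omega_nonneg t ω hω _)] at h
    have := h 1 (Finset.mem_univ _)
    convert this using 2
    ext i; simp [actZ]
  have hs : Summable ω := summable_of_ne_finset_zero (s := S) hsupp
  have h1 : ∑' n, ∑ p : BG, ω (actZ p n) = 48 * ∑' n, ω n := by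
    rw [Summable.tsum_finsetSum (f := fun p n => ω (actZ p n)) (fun p _ => (actZ p).summable_iff.2 hs)]
    simp only [Equiv.tsum_eq]
    rw [Finset.sum_const, Finset.card_univ, nsmul_eq_mul]
    congr 1
  have h2 : ∑' n, ∑ p : BG, ω (actZ p n) = (2 * (t - B1bar t)) ^ 3 := by
    simp only [sum_omega t ht ω hω]
    rw [tsum_eq_sum (s := S) hW, ← uu_sum t ht]
    have := Finset.prod_univ_sum (fun _ : Fin 3 => Finset.Icc (-⌊t⌋) ⌊t⌋) (fun _ k => ((uu t (k : ℤ) : ℝ) / 2))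
    rw [← this]
    simp
  rw [h1] at h2
  linarith

/-- The solid angle sum of the order simplex `◁ ⊂ ℝ³` for all positive real dilates `t`;
in particular it equals `t³/6` at positive integers `t`, so `◁` is a concrete polytope. -/
theorem solid_angle_sum_order_simplex (t : ℝ) (ht : 0 < t)
    (ω : (Fin 3 → ℤ) → ℝ)
    (hω : ∀ n : Fin 3 → ℤ, saTendsto (t • orderSimplex3) (fun i => (n i : ℝ)) (ω n)) :
    (∑' n : Fin 3 → ℤ, ω n =
      (1/6) * t^3 - (1/2) * B1bar t * t^2 +
        (1/24 + (1/2) * B2bar t - (1/8) * indZ t) * t -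
        B1bar t * ((1/6) * B2bar t + 1/72)) ∧
    ((∃ m : ℤ, t = m) → ∑' n : Fin 3 → ℤ, ω n = (1/6) * t^3) := by
  have hm := main_sum t ht ω hω
  constructor
  · rw [hm]
    unfold B1bar B2bar indZ
    split_ifs with h
    · obtain ⟨m, rfl⟩ := h
      simp only [Int.fract_intCast]
      ring
    · ring
  · intro h
    rw [hm]
    unfold B1bar
    rw [if_pos h]
    ring
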